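/- Suppose η ≥ η₀ = max(n, (32/γ²)·log(256/γ²)), t ≥ 1, F(w_s) > 1/(8η) for all s ≤ t, and |w̃_t| ≤ η. If w̃_{t+1}·w̃_t ≥ 0 (no sign change of the orthogonal component from step t to t+1), then w̃_t·(w̃_{t+1} − w̃_t) < 0 and consequently |w̃_{t+1}| ≤ |w̃_t|. -/

import Mathlib

open scoped InnerProductSpace BigOperators
open Finset

/-- Logistic loss `F(w) = (1/n) ∑ᵢ log(1 + exp(−⟨w, xᵢ⟩))`. -/
noncomputable def logisticLoss (n : ℕ) (x : Fin n → EuclideanSpace ℝ (Fin 2))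
    (w : EuclideanSpace ℝ (Fin 2)) : ℝ :=
  (n : ℝ)⁻¹ * ∑ i, Real.log (1 + Real.exp (-⟪w, x i⟫_ℝ))

/-- Gradient potential `G(w) = (1/n) ∑ᵢ 1/(exp(⟨w, xᵢ⟩) + 1)`. -/
noncomputable def gradPotential (n : ℕ) (x : Fin n → EuclideanSpace ℝ (Fin 2))
    (w : EuclideanSpace ℝ (Fin 2)) : ℝ :=
  (n : ℝ)⁻¹ * ∑ i, (Real.exp ⟪w, x i⟫_ℝ + 1)⁻¹

/-- Gradient descent iterates: `w₀ = 0`, `w_{t+1} = w_t − η ∇F(w_t)`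
(the gradient of the logistic loss is written in closed form). -/
noncomputable def gdIter (n : ℕ) (x : Fin n → EuclideanSpace ℝ (Fin 2)) (η : ℝ) :
    ℕ → EuclideanSpace ℝ (Fin 2)
  | 0 => 0
  | t + 1 => gdIter n x η t
      + (η / n) • ∑ i, (Real.exp ⟪gdIter n x η t, x i⟫_ℝ + 1)⁻¹ • x i

/-- `γ` is the maximum margin of the dataset `x`:
it is the greatest `m` such that some unit vector `w` satisfies `⟨w, xᵢ⟩ ≥ m` for all `i`. -/
def isMaxMargin (n : ℕ) (x : Fin n → EuclideanSpace ℝ (Fin 2)) (γ : ℝ) : Prop :=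
  IsGreatest {m : ℝ | ∃ w : EuclideanSpace ℝ (Fin 2), ‖w‖ = 1 ∧ ∀ i, m ≤ ⟪w, x i⟫_ℝ} γ

/-- Parseval's identity for inner products in an orthonormal pair of plane vectors. -/
lemma inner_eq_of_orthonormal_pair {u v : EuclideanSpace ℝ (Fin 2)} (hu : ‖u‖ = 1) (hv : ‖v‖ = 1)
    (hvu : ⟪v, u⟫_ℝ = 0) (w x : EuclideanSpace ℝ (Fin 2)) :
    ⟪w, x⟫_ℝ = ⟪w, u⟫_ℝ * ⟪u, x⟫_ℝ + ⟪w, v⟫_ℝ * ⟪v, x⟫_ℝ := by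
  have huv : ⟪u, v⟫_ℝ = 0 := by rwa [real_inner_comm]
  have ho : Orthonormal ℝ ![u, v] := by
    refine ⟨fun i ↦ by fin_cases i <;> simpa, fun i j hij ↦ ?_⟩
    fin_cases i <;> fin_cases j <;> first | exact absurd rfl hij | exact hvu | exact huv
  let b := basisOfOrthonormalOfCardEqFinrank ho (by simp)
  have hb : (b : Fin 2 → EuclideanSpace ℝ (Fin 2)) = ![u, v] :=
    coe_basisOfOrthonormalOfCardEqFinrank ho (by simp)
  have hs := (b.toOrthonormalBasis (by rwa [hb])).sum_inner_mul_inner w x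
  rw [← hs]
  simp [hb]

lemma inner_gdIter_succ (n : ℕ) (x : Fin n → EuclideanSpace ℝ (Fin 2)) (η : ℝ) (t : ℕ)
    (v : EuclideanSpace ℝ (Fin 2)) :
    ⟪gdIter n x η (t + 1), v⟫_ℝ = ⟪gdIter n x η t, v⟫_ℝ
      + η / n * ∑ i, (Real.exp ⟪gdIter n x η t, x i⟫_ℝ + 1)⁻¹ * ⟪v, x i⟫_ℝ := by
  simp only [gdIter, inner_add_left, real_inner_smul_left, sum_inner]
  simp only [real_inner_comm]

/-- After the first step, the component along a separating direction is at least `η γ / 2`. -/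
lemma le_inner_gdIter {n : ℕ} (hn : 0 < n) {x : Fin n → EuclideanSpace ℝ (Fin 2)} {γ η : ℝ}
    (hγ : 0 ≤ γ) (hη : 0 ≤ η) {w : EuclideanSpace ℝ (Fin 2)} (hw : ∀ i, γ ≤ ⟪w, x i⟫_ℝ)
    {t : ℕ} (ht : 1 ≤ t) : η * γ / 2 ≤ ⟪gdIter n x η t, w⟫_ℝ := by
  induction t, ht using Nat.le_induction with
  | base =>
    have hn' : (0 : ℝ) < n := by exact_mod_cast hn
    have hstep := inner_gdIter_succ n x η 0 w
    rw [zero_add] at hstep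
    rw [hstep]
    have hsum : ∑ _i : Fin n, (1 / 2 : ℝ) * γ ≤
        ∑ i, (Real.exp ⟪gdIter n x η 0, x i⟫_ℝ + 1)⁻¹ * ⟪w, x i⟫_ℝ := by
      refine Finset.sum_le_sum fun i _ ↦ ?_
      simp only [gdIter, inner_zero_left, Real.exp_zero]
      linarith [hw i]
    have := mul_le_mul_of_nonneg_left hsum (div_nonneg hη hn'.le)
    simp only [Finset.sum_const, Finset.card_univ, Fintype.card_fin, nsmul_eq_mul] at this
    have he : η / n * (n * (1 / 2 * γ)) = η * γ / 2 := by field_simp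
    simp only [gdIter, inner_zero_left] at this ⊢
    linarith
  | succ t _ ih =>
    rw [inner_gdIter_succ]
    have : 0 ≤ η / n * ∑ i, (Real.exp ⟪gdIter n x η t, x i⟫_ℝ + 1)⁻¹ * ⟪w, x i⟫_ℝ :=
      mul_nonneg (by positivity) (Finset.sum_nonneg fun i _ ↦
        mul_nonneg (by positivity) (hγ.trans (hw i)))
    linarith

/-- Some data point has loss at least the average loss, hence a small exponentiated margin. -/
lemma exists_exp_inner_lt {n : ℕ} {x : Fin n → EuclideanSpace ℝ (Fin 2)} (hn : 0 < n)
    {w : EuclideanSpace ℝ (Fin 2)} {c : ℝ} (hc : 0 < c) (h : 1 / c < logisticLoss n x w) :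
    ∃ i, Real.exp ⟪w, x i⟫_ℝ < c := by
  by_contra! hcon
  have hn' : (0 : ℝ) < n := by exact_mod_cast hn
  have hsum : ∑ i, Real.log (1 + Real.exp (-⟪w, x i⟫_ℝ)) ≤ ∑ _i : Fin n, 1 / c := by
    refine Finset.sum_le_sum fun i _ ↦ ?_
    have h₁ := Real.log_le_sub_one_of_pos (x := 1 + Real.exp (-⟪w, x i⟫_ℝ)) (by positivity)
    have h₂ : Real.exp (-⟪w, x i⟫_ℝ) ≤ 1 / c := by
      rw [Real.exp_neg, ← one_div]
      exact one_div_le_one_div_of_le hc (hcon i)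
    linarith
  have := mul_le_mul_of_nonneg_left hsum (inv_nonneg.2 hn'.le)
  simp only [Finset.sum_const, Finset.card_univ, Fintype.card_fin, nsmul_eq_mul,
    inv_mul_cancel_left₀ hn'.ne'] at this
  exact absurd h (not_lt.2 this)

/-- The lower bound on the step size makes `exp (η γ² / 32)` dominate both `√η` and `γ⁻²`. -/
lemma exp_bounds_of_stepsize {γ η : ℝ} (hγ0 : 0 < γ)
    (hη : 32 / γ ^ 2 * Real.log (256 / γ ^ 2) ≤ η) :
    256 ≤ γ ^ 2 * Real.exp (η * γ ^ 2 / 32) ∧ 8 * η ≤ Real.exp (η * γ ^ 2 / 32) ^ 2 := by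
  have hg : 0 < γ ^ 2 := by positivity
  have h₁ : Real.log (256 / γ ^ 2) ≤ η * γ ^ 2 / 32 := by
    have := mul_le_mul_of_nonneg_right hη (by positivity : 0 ≤ γ ^ 2 / 32)
    calc Real.log (256 / γ ^ 2) = 32 / γ ^ 2 * Real.log (256 / γ ^ 2) * (γ ^ 2 / 32) := by
          field_simp
      _ ≤ _ := by linarith
  have h₂ : 256 / γ ^ 2 ≤ Real.exp (η * γ ^ 2 / 32) := by
    rwa [← Real.log_le_iff_le_exp (by positivity)]
  have h₃ : 256 ≤ γ ^ 2 * Real.exp (η * γ ^ 2 / 32) := by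
    rwa [div_le_iff₀' hg] at h₂
  refine ⟨h₃, ?_⟩
  have h₄ := Real.add_one_le_exp (η * γ ^ 2 / 32)
  have h₅ := Real.exp_pos (η * γ ^ 2 / 32)
  set y := Real.exp (η * γ ^ 2 / 32)
  have h₆ : γ ^ 2 * (8 * η) ≤ γ ^ 2 * y ^ 2 := by nlinarith
  exact le_of_mul_le_mul_left h₆ hg

/-- If the orthogonal component is nonnegative and at most `η` while the loss is still large,
then it is positive and the next step strictly decreases it. -/
lemma orthogonal_component_decreases {n : ℕ} (hn : 0 < n)
    {x : Fin n → EuclideanSpace ℝ (Fin 2)} (hx : ∀ i, ‖x i‖ ≤ 1) {γ : ℝ} (hγ0 : 0 < γ)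
    {w : EuclideanSpace ℝ (Fin 2)} (hw : ‖w‖ = 1) (hsep : ∀ i, γ ≤ ⟪w, x i⟫_ℝ)
    {v : EuclideanSpace ℝ (Fin 2)} (hv : ‖v‖ = 1) (hvw : ⟪v, w⟫_ℝ = 0)
    {η : ℝ} (hη : max (n : ℝ) (32 / γ ^ 2 * Real.log (256 / γ ^ 2)) ≤ η)
    {t : ℕ} (ht : 1 ≤ t) (hloss : 1 / (8 * η) < logisticLoss n x (gdIter n x η t))
    (hnonneg : 0 ≤ ⟪gdIter n x η t, v⟫_ℝ) (hle : ⟪gdIter n x η t, v⟫_ℝ ≤ η) :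
    0 < ⟪gdIter n x η t, v⟫_ℝ ∧ ⟪gdIter n x η (t + 1), v⟫_ℝ < ⟪gdIter n x η t, v⟫_ℝ := by
  obtain ⟨hηn, hηγ⟩ := max_le_iff.1 hη
  have hn1 : (1 : ℝ) ≤ n := by exact_mod_cast hn
  have hη0 : 0 < η := by linarith
  obtain ⟨hy₁, hy₂⟩ := exp_bounds_of_stepsize hγ0 hηγ
  have ha := le_inner_gdIter hn hγ0.le hη0.le hsep ht
  obtain ⟨j, hj⟩ := exists_exp_inner_lt hn (by positivity) hloss
  have hdecomp := fun i ↦ inner_eq_of_orthonormal_pair hw hv hvw (gdIter n x η t) (x i)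
  have hexp : ∀ k : ℕ, Real.exp (η * γ ^ 2 / 32) ^ k = Real.exp (k * (η * γ ^ 2 / 32)) :=
    fun k ↦ (Real.exp_nat_mul _ _).symm
  have hy1 : 1 ≤ Real.exp (η * γ ^ 2 / 32) := Real.one_le_exp (by positivity)
  have hpar : ∀ i, η * γ ^ 2 / 2 ≤ ⟪gdIter n x η t, w⟫_ℝ * ⟪w, x i⟫_ℝ := fun i ↦ by
    have := mul_le_mul ha (hsep i) hγ0.le ((by positivity : 0 ≤ η * γ / 2).trans ha)
    nlinarith
  have hmj : ⟪gdIter n x η t, x j⟫_ℝ < η * γ ^ 2 / 4 := by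
    rw [← Real.exp_lt_exp]
    have h₁ := pow_le_pow_right₀ hy1 (by norm_num : 2 ≤ 8)
    rw [hexp 8] at h₁
    have h₂ : ((8 : ℕ) : ℝ) * (η * γ ^ 2 / 32) = η * γ ^ 2 / 4 := by push_cast; ring
    rw [h₂] at h₁
    linarith
  have hbj : ⟪gdIter n x η t, v⟫_ℝ * ⟪v, x j⟫_ℝ < -(η * γ ^ 2 / 4) := by
    linarith [hdecomp j, hpar j]
  have hηγ2 : 0 < η * γ ^ 2 := by positivity
  have hxj : ⟪v, x j⟫_ℝ < -(γ ^ 2 / 4) := by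
    by_contra! hcon
    rcases le_or_gt 0 ⟪v, x j⟫_ℝ with h | h
    · nlinarith
    · nlinarith [mul_le_mul_of_nonpos_right hle h.le]
  have hpos : 0 < ⟪gdIter n x η t, v⟫_ℝ :=
    hnonneg.lt_of_ne fun h ↦ by rw [← h] at hbj; linarith
  refine ⟨hpos, ?_⟩
  set y := Real.exp (η * γ ^ 2 / 32)
  set g : Fin n → ℝ := fun i ↦ (Real.exp ⟪gdIter n x η t, x i⟫_ℝ + 1)⁻¹
  have hg0 : ∀ i, 0 < g i := fun i ↦ by positivity
  have hterm : ∀ i, g i * ⟪v, x i⟫_ℝ ≤ (y ^ 16)⁻¹ := fun i ↦ by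
    have hy0 : 0 ≤ (y ^ 16)⁻¹ := by positivity
    rcases le_or_gt ⟪v, x i⟫_ℝ 0 with h | h
    · exact (mul_nonpos_of_nonneg_of_nonpos (hg0 i).le h).trans hy0
    · have h₁ : ⟪v, x i⟫_ℝ ≤ 1 := by
        have := real_inner_le_norm v (x i)
        rw [hv, one_mul] at this
        exact this.trans (hx i)
      have h₂ : g i ≤ (y ^ 16)⁻¹ := by
        refine inv_anti₀ (by positivity) ?_
        rw [hexp 16]
        have : Real.exp ((16 : ℕ) * (η * γ ^ 2 / 32)) ≤ Real.exp ⟪gdIter n x η t, x i⟫_ℝ := by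
          refine Real.exp_le_exp.2 ?_
          push_cast
          linarith [hdecomp i, hpar i, mul_nonneg hnonneg h.le]
        linarith
      simpa using mul_le_mul h₂ h₁ h.le hy0
  have hgj : (16 * η)⁻¹ ≤ g j := inv_anti₀ (by positivity) (by linarith)
  have htermj : g j * ⟪v, x j⟫_ℝ ≤ -((16 * η)⁻¹ * (γ ^ 2 / 4)) := by
    have := mul_le_mul hgj (by linarith : γ ^ 2 / 4 ≤ -⟪v, x j⟫_ℝ) (by positivity) (hg0 j).le
    linarith
  have hrest : ∑ i ∈ Finset.univ.erase j, g i * ⟪v, x i⟫_ℝ ≤ η * (y ^ 16)⁻¹ := by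
    refine (Finset.sum_le_card_nsmul _ _ _ fun i _ ↦ hterm i).trans ?_
    rw [nsmul_eq_mul]
    refine mul_le_mul_of_nonneg_right (le_trans ?_ hηn) (by positivity)
    exact_mod_cast (Finset.card_le_univ _).trans (Fintype.card_fin n).le
  have hsmall : η * (y ^ 16)⁻¹ < (16 * η)⁻¹ * (γ ^ 2 / 4) := by
    have h₁ : y ^ 4 ≤ y ^ 15 := pow_le_pow_right₀ hy1 (by norm_num)
    have h₂ : (8 * η) ^ 2 ≤ (y ^ 2) ^ 2 := pow_le_pow_left₀ (by positivity) hy₂ 2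
    have h₃ : 256 * y ^ 15 ≤ γ ^ 2 * y * y ^ 15 :=
      mul_le_mul_of_nonneg_right hy₁ (by positivity)
    have h₄ : 64 * η ^ 2 < γ ^ 2 * y ^ 16 := by nlinarith [sq_pos_of_pos hη0]
    have h₅ : (16 * η)⁻¹ * (γ ^ 2 / 4) = γ ^ 2 / (64 * η) := by field_simp; norm_num
    rw [h₅, ← div_eq_mul_inv, div_lt_div_iff₀ (by positivity) (by positivity)]
    linarith
  have hsum : ∑ i, g i * ⟪v, x i⟫_ℝ < 0 := by
    rw [← Finset.add_sum_erase _ _ (Finset.mem_univ j)]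
    linarith
  rw [inner_gdIter_succ]
  have := mul_neg_of_pos_of_neg (by positivity : 0 < η / n) hsum
  linarith

theorem stmt_18 (n : ℕ) (hn : 0 < n) (x : Fin n → EuclideanSpace ℝ (Fin 2))
    (hx : ∀ i, ‖x i‖ ≤ 1) (γ : ℝ) (hγ0 : 0 < γ) (hγ1 : γ < 1)
    (hmm : isMaxMargin n x γ)
    (wst : EuclideanSpace ℝ (Fin 2)) (hws : ‖wst‖ = 1) (hsep : ∀ i, γ ≤ ⟪wst, x i⟫_ℝ)
    (vst : EuclideanSpace ℝ (Fin 2)) (hvs : ‖vst‖ = 1) (hvw : ⟪vst, wst⟫_ℝ = 0)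
    (η : ℝ) (hη : max (n : ℝ) (32 / γ ^ 2 * Real.log (256 / γ ^ 2)) ≤ η)
    (t : ℕ) (ht : 1 ≤ t)
    (hloss : ∀ s : ℕ, s ≤ t → 1 / (8 * η) < logisticLoss n x (gdIter n x η s))
    (hbnd : |⟪gdIter n x η t, vst⟫_ℝ| ≤ η)
    (hsign : 0 ≤ ⟪gdIter n x η (t + 1), vst⟫_ℝ * ⟪gdIter n x η t, vst⟫_ℝ) :
    ⟪gdIter n x η t, vst⟫_ℝ *
        (⟪gdIter n x η (t + 1), vst⟫_ℝ - ⟪gdIter n x η t, vst⟫_ℝ) < 0 ∧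
    |⟪gdIter n x η (t + 1), vst⟫_ℝ| ≤ |⟪gdIter n x η t, vst⟫_ℝ| := by
  rcases le_total 0 ⟪gdIter n x η t, vst⟫_ℝ with h | h
  · rw [abs_of_nonneg h] at hbnd
    obtain ⟨h₁, h₂⟩ := orthogonal_component_decreases hn hx hγ0 hws hsep hvs hvw hη ht
      (hloss t le_rfl) h hbnd
    refine ⟨mul_neg_of_pos_of_neg h₁ (by linarith), ?_⟩
    rw [abs_of_nonneg (nonneg_of_mul_nonneg_left hsign h₁), abs_of_pos h₁]
    exact h₂.le
  · rw [abs_of_nonpos h] at hbnd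
    obtain ⟨h₁, h₂⟩ := orthogonal_component_decreases (v := -vst) hn hx hγ0 hws hsep
      (by rwa [norm_neg]) (by rw [inner_neg_left, hvw, neg_zero]) hη ht
      (hloss t le_rfl) (by rw [inner_neg_right]; linarith) (by rwa [inner_neg_right])
    simp only [inner_neg_right] at h₁ h₂
    refine ⟨mul_neg_of_neg_of_pos (by linarith) (by linarith), ?_⟩
    have h₃ : ⟪gdIter n x η (t + 1), vst⟫_ℝ ≤ 0 := by
      by_contra! h₄
      nlinarith
    rw [abs_of_nonpos h₃, abs_of_nonpos h]
    exact h₂.le
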